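/- Assume the continuum hypothesis. Then there exists a strongly non-Hausdorff p-point ultrafilter on ℕ, i.e., a p-point U such that for every finite-to-one f : ℕ → ℕ, the pushforward f(U) is not weakly Hausdorff. -/

import Mathlib

/-- A function `f : ℕ → ℕ` is finite-to-one if every fiber is finite. -/
def FinToOne (f : ℕ → ℕ) : Prop := ∀ n : ℕ, (f ⁻¹' {n}).Finite

/-- An ultrafilter `U` on `ℕ` is Hausdorff if whenever two functions push it
forward to the same ultrafilter, they agree on a set in `U`. -/
def IsHausdorffUltra (U : Ultrafilter ℕ) : Prop :=
  ∀ f g : ℕ → ℕ, Ultrafilter.map f U = Ultrafilter.map g U →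
    ∃ X ∈ U, ∀ x ∈ X, f x = g x

/-- An ultrafilter `U` on `ℕ` is weakly Hausdorff if whenever two finite-to-one
functions push it forward to the same ultrafilter, they agree on a set in `U`. -/
def IsWeaklyHausdorffUltra (U : Ultrafilter ℕ) : Prop :=
  ∀ f g : ℕ → ℕ, FinToOne f → FinToOne g →
    Ultrafilter.map f U = Ultrafilter.map g U →
    ∃ X ∈ U, ∀ x ∈ X, f x = g x

/-- A nonprincipal ultrafilter `U` on `ℕ` is a p-point if for every countable
family of members of `U` there is a member of `U` almost contained in each. -/
def IsPPoint (U : Ultrafilter ℕ) : Prop :=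
  (∀ n : ℕ, U ≠ pure n) ∧
  ∀ Xs : ℕ → Set ℕ, (∀ n, Xs n ∈ U) → ∃ X ∈ U, ∀ n, (X \ Xs n).Finite

/-- An ultrafilter `U` on `ℕ` is strongly non-Hausdorff if all of its
finite-to-one pushforwards fail to be weakly Hausdorff. -/
def StronglyNonHausdorff (U : Ultrafilter ℕ) : Prop :=
  ∀ f : ℕ → ℕ, FinToOne f → ¬ IsWeaklyHausdorffUltra (Ultrafilter.map f U)

open Cardinal in
/-- In a complete lattice, if the elements satisfying `P` are closed under infima of countable
chains, then some chain of them meets `ℵ₁` many dense requirements. -/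
theorem exists_isChain_of_dense {α ι : Type} [CompleteLattice α] (hι : #ι ≤ ℵ₁) (P : α → Prop)
    (hP : ∀ S : Set α, S.Countable → IsChain (· ≤ ·) S → (∀ s ∈ S, P s) → P (sInf S))
    (D : ι → α → Prop) (hD : ∀ i s, P s → ∃ t ≤ s, P t ∧ D i t) :
    ∃ S : Set α, IsChain (· ≤ ·) S ∧ (∀ s ∈ S, P s) ∧ ∀ i, ∃ s ∈ S, D i s := by
  classical
  obtain ⟨_, _, h⟩ := exists_ord_eq_type_lt ι
  have hcount : ∀ i : ι, (Set.Iio i).Countable := fun i => by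
    rw [← le_aleph0_iff_set_countable, ← lt_aleph_one_iff]
    exact (mk_Iio_lt i h).trans_le hι
  choose! e he_le he_P he_D using hD
  let F : ι → α := (wellFounded_lt (α := ι)).fix fun i ih =>
    e i (sInf (Set.range fun j : Set.Iio i => ih j.1 j.2))
  have hF : ∀ i, F i = e i (sInf (F '' Set.Iio i)) := fun i => by
    rw [Set.image_eq_range]
    exact WellFounded.fix_eq _ _ i
  have key : ∀ i, P (sInf (F '' Set.Iio i)) ∧ ∀ j < i, F i ≤ F j := fun i => by
    induction i using WellFoundedLT.induction with
    | ind i ih =>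
      have hPi : P (sInf (F '' Set.Iio i)) := by
        refine hP _ ((hcount i).image F) ?_ ?_
        · rintro _ ⟨j, hj, rfl⟩ _ ⟨k, hk, rfl⟩ -
          rcases lt_trichotomy j k with hjk | rfl | hjk
          · exact Or.inr ((ih k hk).2 j hjk)
          · exact Or.inl le_rfl
          · exact Or.inl ((ih j hj).2 k hjk)
        · rintro _ ⟨j, hj, rfl⟩
          rw [hF]
          exact he_P _ _ (ih j hj).1
      refine ⟨hPi, fun j hj => ?_⟩
      rw [hF i]
      exact (he_le _ _ hPi).trans (sInf_le ⟨j, hj, rfl⟩)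
  refine ⟨Set.range F, ?_, ?_, fun i => ⟨F i, ⟨i, rfl⟩, ?_⟩⟩
  · rintro _ ⟨j, rfl⟩ _ ⟨k, rfl⟩ -
    rcases lt_trichotomy j k with hjk | rfl | hjk
    · exact Or.inr ((key k).2 j hjk)
    · exact Or.inl le_rfl
    · exact Or.inl ((key j).2 k hjk)
  · rintro _ ⟨i, rfl⟩
    rw [hF]
    exact he_P _ _ (key i).1
  · rw [hF]
    exact he_D _ _ (key i).1

/-- The members of a filter on `ℕ`, as points of Cantor space. -/
def cantorSets (F : Filter ℕ) : Set (ℕ → Bool) := {a | {x | a x = true} ∈ F}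

/-- A filter on `ℕ` is a σ-compact free filter if its members form a σ-compact subset of Cantor
space and are all infinite. -/
structure IsSigmaFree (F : Filter ℕ) : Prop where
  isSigmaCompact : IsSigmaCompact (cantorSets F)
  infinite : ∀ A ∈ F, A.Infinite

theorem mem_sInf_iff_of_isChain {S : Set (Filter ℕ)} (hS : IsChain (· ≤ ·) S) (hne : S.Nonempty)
    {A : Set ℕ} : A ∈ sInf S ↔ ∃ F ∈ S, A ∈ F := by
  rw [sInf_eq_iInf, Filter.mem_biInf_of_directed _ hne]
  exact (show IsChain (· ≥ ·) S from hS.symm).directedOn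

theorem infinite_of_mem_sInf {S : Set (Filter ℕ)} (hS : IsChain (· ≤ ·) S)
    (h : ∀ F ∈ S, ∀ A ∈ F, A.Infinite) {A : Set ℕ} (hA : A ∈ sInf S) : A.Infinite := by
  rcases S.eq_empty_or_nonempty with rfl | hne
  · have : A = Set.univ := by simpa using hA
    exact this ▸ Set.infinite_univ
  · obtain ⟨F, hF, hAF⟩ := (mem_sInf_iff_of_isChain hS hne).1 hA
    exact h F hF A hAF

theorem IsSigmaFree.sInf {S : Set (Filter ℕ)} (hc : S.Countable) (hS : IsChain (· ≤ ·) S)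
    (h : ∀ F ∈ S, IsSigmaFree F) : IsSigmaFree (sInf S) := by
  refine ⟨?_, fun A => infinite_of_mem_sInf hS fun F hF => (h F hF).infinite⟩
  rcases S.eq_empty_or_nonempty with rfl | hne
  · have : cantorSets (InfSet.sInf ∅) = {fun _ => true} := by
      ext a
      simp [cantorSets, Set.eq_univ_iff_forall, funext_iff]
    rw [this]
    exact isCompact_singleton.isSigmaCompact
  · have : cantorSets (InfSet.sInf S) = ⋃ F ∈ S, cantorSets F := by
      ext a
      simp [cantorSets, mem_sInf_iff_of_isChain hS hne]
    rw [this]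
    exact isSigmaCompact_biUnion hc fun F hF => (h F hF).isSigmaCompact

theorem isSigmaCompact_cantorSets_inf {F G : Filter ℕ} (hF : IsSigmaCompact (cantorSets F))
    (hG : IsSigmaCompact (cantorSets G)) : IsSigmaCompact (cantorSets (F ⊓ G)) := by
  classical
  obtain ⟨K, hK, hKF⟩ := hF
  obtain ⟨L, hL, hLG⟩ := hG
  have hcont : Continuous fun p : (ℕ → Bool) × (ℕ → Bool) => fun x => p.1 x && p.2 x := by
    refine continuous_pi fun x => ?_
    exact (continuous_of_discreteTopology (f := fun b : Bool × Bool => b.1 && b.2)).comp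
      (f := fun p : (ℕ → Bool) × (ℕ → Bool) => (p.1 x, p.2 x)) (by fun_prop)
  have : cantorSets (F ⊓ G) = (fun p : (ℕ → Bool) × (ℕ → Bool) => fun x => p.1 x && p.2 x) ''
      ⋃ i : ℕ × ℕ, K i.1 ×ˢ L i.2 := by
    ext a
    have hprod : (⋃ i : ℕ × ℕ, K i.1 ×ˢ L i.2) = cantorSets F ×ˢ cantorSets G := by
      rw [← hKF, ← hLG]
      ext p
      simp
    rw [hprod]
    constructor
    · intro ha
      obtain ⟨A, hA, B, hB, hAB⟩ := Filter.mem_inf_iff.1 ha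
      refine ⟨(fun x => decide (x ∈ A), fun x => decide (x ∈ B)), ⟨?_, ?_⟩, ?_⟩
      · simpa [cantorSets] using hA
      · simpa [cantorSets] using hB
      · funext x
        have : a x = true ↔ x ∈ A ∧ x ∈ B := Set.ext_iff.1 hAB x
        rw [Bool.eq_iff_iff, this]
        simp
    · rintro ⟨⟨b, c⟩, ⟨hb, hc⟩, rfl⟩
      refine Filter.mem_inf_iff.2 ⟨_, hb, _, hc, ?_⟩
      ext x
      simp
  rw [this]
  exact (isSigmaCompact_iUnion_of_isCompact _ fun i : ℕ × ℕ => (hK i.1).prod (hL i.2)).image hcont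

theorem isSigmaCompact_cantorSets_principal (X : Set ℕ) :
    IsSigmaCompact (cantorSets (Filter.principal X)) := by
  have : cantorSets (Filter.principal X) = ⋂ x ∈ X, {a | a x = true} := by
    ext a
    simp [cantorSets, Set.subset_def]
  rw [this]
  refine (IsClosed.isCompact ?_).isSigmaCompact
  exact isClosed_biInter fun x _ => isClosed_eq (continuous_apply x) continuous_const

/-- The filter generated by the sets on which `χ ∘ p` and `χ ∘ q` agree, for finite colourings `χ`.
-/
def colorFilter (p q : ℕ → ℕ) : Filter ℕ where
  sets := {A | ∃ (k : ℕ) (χ : ℕ → Fin k), {x | χ (p x) = χ (q x)} ⊆ A}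
  univ_sets := ⟨1, fun _ => 0, Set.subset_univ _⟩
  sets_of_superset := fun ⟨k, χ, h⟩ hAB => ⟨k, χ, h.trans hAB⟩
  inter_sets := by
    rintro A B ⟨k, χ, hA⟩ ⟨l, ψ, hB⟩
    refine ⟨k * l, fun x => finProdFinEquiv (χ x, ψ x), fun x hx => ?_⟩
    have := finProdFinEquiv.injective hx
    exact ⟨hA (congrArg Prod.fst this), hB (congrArg Prod.snd this)⟩

theorem mem_colorFilter {p q : ℕ → ℕ} {A : Set ℕ} :
    A ∈ colorFilter p q ↔ ∃ (k : ℕ) (χ : ℕ → Fin k), {x | χ (p x) = χ (q x)} ⊆ A := Iff.rfl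

theorem setOf_mem_iff_mem_colorFilter (p q : ℕ → ℕ) (A : Set ℕ) :
    {x | p x ∈ A ↔ q x ∈ A} ∈ colorFilter p q := by
  classical
  refine ⟨2, fun x => if x ∈ A then 1 else 0, fun x hx => ?_⟩
  by_cases h₁ : p x ∈ A <;> by_cases h₂ : q x ∈ A <;> simp_all

theorem isSigmaCompact_cantorSets_colorFilter (p q : ℕ → ℕ) :
    IsSigmaCompact (cantorSets (colorFilter p q)) := by
  let φ (k : ℕ) (c : (ℕ → Fin k) × (ℕ → Bool)) (x : ℕ) : Bool :=
    decide (c.1 (p x) = c.1 (q x)) || c.2 x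
  have hφ : ∀ k, Continuous (φ k) := fun k => by
    refine continuous_pi fun x => ?_
    exact (continuous_of_discreteTopology
      (f := fun b : Fin k × Fin k × Bool => decide (b.1 = b.2.1) || b.2.2)).comp
      (f := fun c : (ℕ → Fin k) × (ℕ → Bool) => (c.1 (p x), c.1 (q x), c.2 x)) (by fun_prop)
  have : cantorSets (colorFilter p q) = ⋃ k, Set.range (φ k) := by
    ext a
    simp only [cantorSets, Set.mem_ofPred_eq, mem_colorFilter, Set.mem_iUnion, Set.mem_range]
    refine exists_congr fun k => ⟨?_, ?_⟩
    · rintro ⟨χ, h⟩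
      refine ⟨(χ, a), funext fun x => ?_⟩
      have := @h x
      by_cases hx : χ (p x) = χ (q x) <;> simp_all [φ]
    · rintro ⟨⟨χ, b⟩, rfl⟩
      refine ⟨χ, fun x hx => ?_⟩
      have hx' : χ (p x) = χ (q x) := hx
      simp [φ, hx']
  rw [this]
  exact isSigmaCompact_iUnion_of_isCompact _ fun k => isCompact_range (hφ k)

theorem exists_forall_exists_lt_of_isCompact {K : Set (ℕ → Bool)} (hK : IsCompact K) (f : ℕ → ℕ)
    (Y : Set ℕ) (h : ∀ a ∈ K, ∃ x ∈ Y, a x = true) :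
    ∃ m, ∀ a ∈ K, ∃ x ∈ Y, a x = true ∧ f x < m := by
  obtain ⟨m, hm⟩ := hK.elim_directed_cover
    (fun m : ℕ => ⋃ x ∈ {x | x ∈ Y ∧ f x < m}, {a : ℕ → Bool | a x = true})
    (fun m => isOpen_biUnion fun x _ =>
      (isOpen_discrete ({true} : Set Bool)).preimage
        (continuous_apply (A := fun _ : ℕ => Bool) x))
    (fun a ha => by
      obtain ⟨x, hx, hax⟩ := h a ha
      simp only [Set.mem_iUnion]
      exact ⟨f x + 1, x, ⟨hx, Nat.lt_succ_self _⟩, hax⟩)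
    (Monotone.directed_le fun m n hmn =>
      Set.biUnion_subset_biUnion_left fun x hx => ⟨hx.1, hx.2.trans_le hmn⟩)
  refine ⟨m, fun a ha => ?_⟩
  obtain ⟨x, hx, hax⟩ := Set.mem_iUnion₂.1 (hm ha)
  exact ⟨x, hx.1, hax, hx.2⟩

theorem IsSigmaFree.exists_monotone_cover {F : Filter ℕ} (hF : IsSigmaFree F) :
    ∃ K : ℕ → Set (ℕ → Bool), Monotone K ∧ (∀ n, IsCompact (K n)) ∧
      (∀ n, ∀ a ∈ K n, {x | a x = true} ∈ F) ∧
      ∀ A ∈ F, ∃ n, ∃ a ∈ K n, ∀ x, a x = true ↔ x ∈ A := by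
  classical
  obtain ⟨K, hK, hKF⟩ := hF.isSigmaCompact
  refine ⟨Set.accumulate K, Set.monotone_accumulate, isCompact_accumulate hK, ?_, fun A hA => ?_⟩
  · intro n a ha
    have : a ∈ ⋃ n, Set.accumulate K n := Set.mem_iUnion.2 ⟨n, ha⟩
    rw [Set.iUnion_accumulate, hKF] at this
    exact this
  · have : (fun x => decide (x ∈ A)) ∈ ⋃ n, Set.accumulate K n := by
      rw [Set.iUnion_accumulate, hKF]
      simpa [cantorSets] using hA
    obtain ⟨n, hn⟩ := Set.mem_iUnion.1 this
    exact ⟨n, _, hn, fun x => by simp⟩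

theorem FinToOne.finite_preimage {f : ℕ → ℕ} (hf : FinToOne f) {s : Set ℕ} (hs : s.Finite) :
    (f ⁻¹' s).Finite := hs.preimage' fun b _ => hf b

theorem FinToOne.comp {f g : ℕ → ℕ} (hf : FinToOne f) (hg : FinToOne g) : FinToOne (f ∘ g) :=
  fun n => hg.finite_preimage (hf n)

/-- A σ-compact free filter can be extended to contain a pseudointersection of a given sequence of
sets, or else the complement of one of them. -/
theorem IsSigmaFree.exists_le_pseudointersection {F : Filter ℕ} (hF : IsSigmaFree F)
    (Xs : ℕ → Set ℕ) :
    ∃ G ≤ F, IsSigmaFree G ∧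
      ((∃ n, (Xs n)ᶜ ∈ G) ∨ ∃ X ∈ G, ∀ n, (X \ Xs n).Finite) := by
  by_cases h : ∃ n, ∀ A ∈ F, (A \ Xs n).Infinite
  · obtain ⟨n, hn⟩ := h
    refine ⟨F ⊓ Filter.principal (Xs n)ᶜ, inf_le_left, ⟨isSigmaCompact_cantorSets_inf
      hF.isSigmaCompact (isSigmaCompact_cantorSets_principal _), fun A hA => ?_⟩,
      Or.inl ⟨n, Filter.mem_inf_of_right (Filter.mem_principal_self _)⟩⟩
    rw [Filter.mem_inf_principal] at hA
    refine (hn _ hA).mono ?_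
    rintro x ⟨h₁, h₂⟩
    exact h₁ h₂
  · push Not at h
    choose A hAF hA using h
    obtain ⟨K, hmono, hK, hKF, hcov⟩ := hF.exists_monotone_cover
    let Y (n : ℕ) : Set ℕ := (⋂ i ∈ Set.Iic n, A i) ∩ Set.Ici n
    have hY : ∀ n, ∀ a ∈ K n, ∃ x ∈ Y n, a x = true := fun n a ha => by
      have h₁ : (⋂ i ∈ Set.Iic n, A i) ∈ F :=
        (Filter.biInter_mem (Set.finite_Iic n)).2 fun i _ => hAF i
      obtain ⟨x, hx, hnx⟩ := (hF.infinite _ (Filter.inter_mem (hKF n a ha) h₁)).exists_gt n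
      exact ⟨x, ⟨hx.2, hnx.le⟩, hx.1⟩
    choose m hm using fun n => exists_forall_exists_lt_of_isCompact (hK n) id (Y n) (hY n)
    let X : Set ℕ := ⋃ n, Y n ∩ Set.Iio (m n)
    refine ⟨F ⊓ Filter.principal X, inf_le_left, ⟨isSigmaCompact_cantorSets_inf
      hF.isSigmaCompact (isSigmaCompact_cantorSets_principal _), fun B hB => ?_⟩,
      Or.inr ⟨X, Filter.mem_inf_of_right (Filter.mem_principal_self _), fun i => ?_⟩⟩
    · rw [Filter.mem_inf_principal] at hB
      obtain ⟨n, a, ha, haB⟩ := hcov _ hB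
      refine Set.infinite_of_forall_exists_gt fun b => ?_
      obtain ⟨x, hxY, hax, hxm⟩ := hm (max n (b + 1)) a (hmono (le_max_left _ _) ha)
      refine ⟨x, (haB x).1 hax (Set.mem_iUnion.2 ⟨_, hxY, hxm⟩), ?_⟩
      exact (le_max_right n (b + 1)).trans hxY.2
    · have hfin : (⋃ n ∈ Set.Iio i, Set.Iio (m n)).Finite :=
        (Set.finite_Iio i).biUnion fun n _ => Set.finite_Iio _
      refine ((hA i).union hfin).subset ?_
      rintro x ⟨hx, hxi⟩
      obtain ⟨n, hxY, hxm⟩ := Set.mem_iUnion.1 hx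
      by_cases hni : n < i
      · exact Or.inr (Set.mem_iUnion₂.2 ⟨n, hni, hxm⟩)
      · exact Or.inl ⟨Set.mem_iInter₂.1 hxY.1 i (not_lt.1 hni), hxi⟩

/-- Below a σ-compact free filter, every finite-to-one map can be coarsened to one whose
pushforward is the cofinite filter. -/
theorem IsSigmaFree.exists_finToOne_comp {F : Filter ℕ} (hF : IsSigmaFree F) {f : ℕ → ℕ}
    (hf : FinToOne f) :
    ∃ c : ℕ → ℕ, FinToOne c ∧ ∀ A ∈ F, ∃ N, ∀ n ≥ N, ∃ x ∈ A, c (f x) = n := by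
  obtain ⟨K, hmono, hK, hKF, hcov⟩ := hF.exists_monotone_cover
  have step : ∀ n b, ∃ m, b < m ∧ ∀ a ∈ K n, ∃ x, a x = true ∧ b ≤ f x ∧ f x < m := by
    intro n b
    obtain ⟨m, hm⟩ := exists_forall_exists_lt_of_isCompact (hK n) f {x | b ≤ f x} fun a ha => by
      obtain ⟨x, hx, hxb⟩ := ((hF.infinite _ (hKF n a ha)).sdiff
        (hf.finite_preimage (Set.finite_Iio b))).nonempty
      exact ⟨x, show b ≤ f x from not_lt.1 fun h => hxb h, hx⟩
    refine ⟨max m (b + 1), (Nat.lt_succ_self b).trans_le (le_max_right _ _), fun a ha => ?_⟩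
    obtain ⟨x, hbx, hax, hxm⟩ := hm a ha
    exact ⟨x, hax, hbx, hxm.trans_le (le_max_left _ _)⟩
  choose next hlt hnext using step
  let b (n : ℕ) : ℕ := Nat.rec 0 (fun n bn => next n bn) n
  have hb : StrictMono b := strictMono_nat_of_lt_succ fun n => hlt n (b n)
  have hex : ∀ k, ∃ n, k < b (n + 1) := fun k => ⟨k, hb.le_apply⟩
  classical
  refine ⟨fun k => Nat.find (hex k), fun n => ?_, fun A hA => ?_⟩
  · refine (Set.finite_Iio (b (n + 1))).subset ?_
    rintro k rfl
    exact Nat.find_spec (hex k)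
  · obtain ⟨N, a, ha, haA⟩ := hcov A hA
    refine ⟨N, fun n hn => ?_⟩
    obtain ⟨x, hax, hbx, hxb⟩ := hnext n (b n) a (hmono hn ha)
    refine ⟨x, (haA x).1 hax, (Nat.find_eq_iff _).2 ⟨hxb, fun j hj => ?_⟩⟩
    exact not_lt.2 ((hb.monotone hj).trans hbx)

/-- There is a locally finite enumerated graph on `ℕ` of infinite chromatic number, given by its
endpoint maps. -/
theorem exists_finToOne_forall_coloring_infinite :
    ∃ p q : ℕ → ℕ, FinToOne p ∧ FinToOne q ∧ (∀ e, p e ≠ q e) ∧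
      ∀ (k : ℕ) (χ : ℕ → Fin k), {e | χ (p e) = χ (q e)}.Infinite := by
  refine ⟨Nat.sqrt, fun e => e.sqrt + 1 + (e - e.sqrt * e.sqrt), fun n => ?_, fun n => ?_,
    fun e => by dsimp only; omega, fun k χ => ?_⟩
  · refine (Set.finite_Iio ((n + 1) * (n + 1))).subset ?_
    rintro e rfl
    exact Nat.sqrt_lt.1 (Nat.lt_succ_self _)
  · refine (Set.finite_Iio (n * n)).subset fun e he => ?_
    have : e.sqrt < n := by
      have : e.sqrt + 1 + (e - e.sqrt * e.sqrt) = n := he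
      omega
    exact Nat.sqrt_lt.1 this
  · refine Set.infinite_of_forall_exists_gt fun N => ?_
    let M := N + k + 1
    obtain ⟨i, j, hij, hχ⟩ : ∃ i j : Fin (k + 1), i < j ∧ χ (M + i) = χ (M + j) := by
      obtain ⟨i, j, hne, h⟩ := Fintype.exists_ne_map_eq_of_card_lt
        (fun i : Fin (k + 1) => χ (M + i)) (by simp)
      rcases lt_or_gt_of_ne hne with h' | h'
      · exact ⟨i, j, h', h⟩
      · exact ⟨j, i, h', h.symm⟩
    have hij' : (i : ℕ) < j := hij
    have hj := j.2
    have hs : ((M + i) * (M + i) + (j - i - 1)).sqrt = M + i :=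
      Nat.sqrt_add_eq _ (by omega)
    refine ⟨(M + i) * (M + i) + (j - i - 1), ?_, ?_⟩
    · simp only [Set.mem_ofPred_eq, hs, Nat.add_sub_cancel_left]
      rw [hχ]
      congr 1
      omega
    · have : M + i ≤ (M + i) * (M + i) := Nat.le_mul_self _
      omega

/-- A σ-compact free filter can be extended to force the image under a finite-to-one map not to be
weakly Hausdorff. -/
theorem IsSigmaFree.exists_le_colorFilter {F : Filter ℕ} (hF : IsSigmaFree F) {f : ℕ → ℕ}
    (hf : FinToOne f) :
    ∃ G ≤ F, IsSigmaFree G ∧ ∃ g h : ℕ → ℕ, FinToOne g ∧ FinToOne h ∧ (∀ k, g k ≠ h k) ∧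
      ∀ A : Set ℕ, {x | g (f x) ∈ A ↔ h (f x) ∈ A} ∈ G := by
  obtain ⟨c, hc, hcF⟩ := hF.exists_finToOne_comp hf
  obtain ⟨p, q, hp, hq, hpq, hχ⟩ := exists_finToOne_forall_coloring_infinite
  refine ⟨F ⊓ colorFilter (p ∘ c ∘ f) (q ∘ c ∘ f), inf_le_left, ⟨isSigmaCompact_cantorSets_inf
    hF.isSigmaCompact (isSigmaCompact_cantorSets_colorFilter _ _), fun A hA => ?_⟩,
    p ∘ c, q ∘ c, hp.comp hc, hq.comp hc, fun k => hpq (c k),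
    fun A => Filter.mem_inf_of_right (setOf_mem_iff_mem_colorFilter _ _ A)⟩
  obtain ⟨B, hB, C, ⟨k, χ, hC⟩, rfl⟩ := Filter.mem_inf_iff.1 hA
  obtain ⟨N, hN⟩ := hcF B hB
  refine Set.Infinite.of_image (c ∘ f) (((hχ k χ).sdiff (Set.finite_Iio N)).mono ?_)
  rintro e ⟨he, heN⟩
  obtain ⟨x, hx, rfl⟩ := hN e (not_lt.1 heN)
  exact ⟨x, ⟨hx, hC he⟩, rfl⟩

/-- Under CH there is a strongly non-Hausdorff p-point. -/
theorem exists_stronglyNonHausdorff_pPoint_of_CH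
    (ch : (2 : Cardinal) ^ Cardinal.aleph0 = Cardinal.aleph 1) :
    ∃ U : Ultrafilter ℕ, IsPPoint U ∧ StronglyNonHausdorff U := by
  classical
  have hcard : Cardinal.mk ((ℕ → Set ℕ) ⊕ {f : ℕ → ℕ // FinToOne f}) ≤ Cardinal.aleph 1 := by
    have ch' : (2 : Cardinal.{0}) ^ Cardinal.aleph0 = Cardinal.aleph 1 :=
      Cardinal.lift_injective (by simpa using ch)
    rw [← ch', Cardinal.mk_sum, Cardinal.lift_id, Cardinal.lift_id]
    refine Cardinal.add_le_of_le ?_ ?_ ?_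
    · exact (Cardinal.cantor _).le
    · simp
    · exact (Cardinal.mk_subtype_le _).trans (by simp)
  obtain ⟨S, hS, hfree, hD⟩ := exists_isChain_of_dense hcard IsSigmaFree
    (fun S hc hS h => IsSigmaFree.sInf hc hS h)
    (Sum.elim
      (fun Xs G => (∃ n, (Xs n)ᶜ ∈ G) ∨ ∃ X ∈ G, ∀ n, (X \ Xs n).Finite)
      (fun f G => ∃ g h : ℕ → ℕ, FinToOne g ∧ FinToOne h ∧ (∀ k, g k ≠ h k) ∧
        ∀ A : Set ℕ, {x | g (f.1 x) ∈ A ↔ h (f.1 x) ∈ A} ∈ G))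
    (by
      rintro (Xs | f) F hF
      · exact hF.exists_le_pseudointersection Xs
      · exact hF.exists_le_colorFilter f.2)
  have hne : (sInf S ⊓ Filter.cofinite).NeBot := Filter.inf_neBot_iff.2 fun A hA B hB =>
    ((infinite_of_mem_sInf hS (fun F hF => (hfree F hF).infinite) hA).sdiff
      (Filter.mem_cofinite.1 hB)).nonempty.mono fun x hx => ⟨hx.1, not_not.1 hx.2⟩
  let U := Ultrafilter.of (sInf S ⊓ Filter.cofinite)
  have hU : ∀ F ∈ S, ∀ A ∈ F, A ∈ U := fun F hF A hA =>
    Ultrafilter.of_le _ (Filter.mem_inf_of_left (sInf_le hF hA))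
  refine ⟨U, ⟨fun n hn => ?_, fun Xs hXs => ?_⟩, fun f hf hwH => ?_⟩
  · have : ({n} : Set ℕ)ᶜ ∈ U :=
      Ultrafilter.of_le _ (Filter.mem_inf_of_right (Set.finite_singleton n).compl_mem_cofinite)
    rw [hn] at this
    exact this rfl
  · obtain ⟨F, hF, ⟨n, hn⟩ | ⟨X, hX, hfin⟩⟩ := hD (Sum.inl Xs)
    · exact absurd (hXs n) (Ultrafilter.compl_mem_iff_notMem.1 (hU F hF _ hn))
    · exact ⟨X, hU F hF X hX, hfin⟩
  · obtain ⟨F, hF, g, h, hg, hh, hgh, hA⟩ := hD (Sum.inr ⟨f, hf⟩)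
    obtain ⟨X, hX, hXeq⟩ := hwH g h hg hh (Ultrafilter.ext fun A => by
      simp only [Ultrafilter.mem_map]
      exact Filter.congr_sets (hU F hF _ (hA A)))
    obtain ⟨x, hx⟩ := Ultrafilter.nonempty_of_mem hX
    exact hgh x (hXeq x hx)
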